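/- Let U ⊆ ℝ² be an open connected set, f = (f₁, f₂) : U → ℝ² a C² map with det Df(z) ≠ 0 for every z ∈ U, and z₀ ∈ U a point with f(z₀) = (0,0). If every point z ∈ U \ {z₀} lies on a periodic solution of ∇H_f^⊥ whose image is contained in U, then for every h ∈ ℝ the level set H_f^{-1}{h} = {z ∈ U : H_f(z) = h} is connected. -/

import Mathlib

open Real Set

/-- Partial derivative in the `x` direction. -/
noncomputable def pdx (g : ℝ × ℝ → ℝ) (z : ℝ × ℝ) : ℝ := fderiv ℝ g z (1, 0)

/-- Partial derivative in the `y` direction. -/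
noncomputable def pdy (g : ℝ × ℝ → ℝ) (z : ℝ × ℝ) : ℝ := fderiv ℝ g z (0, 1)

/-- The Hamiltonian `H_f = (f₁² + f₂²)/2`. -/
noncomputable def Ham (f : ℝ × ℝ → ℝ × ℝ) (z : ℝ × ℝ) : ℝ :=
  ((f z).1 ^ 2 + (f z).2 ^ 2) / 2

/-- The Hamiltonian vector field `∇H_f^⊥ = (−∂H_f/∂y, ∂H_f/∂x)`. -/
noncomputable def hamVF (f : ℝ × ℝ → ℝ × ℝ) (z : ℝ × ℝ) : ℝ × ℝ :=
  (-(pdy (Ham f) z), pdx (Ham f) z)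

/-- The Jacobian determinant `det Df = ∂f₁/∂x ∂f₂/∂y − ∂f₂/∂x ∂f₁/∂y`. -/
noncomputable def jacDet (f : ℝ × ℝ → ℝ × ℝ) (z : ℝ × ℝ) : ℝ :=
  pdx (fun w => (f w).1) z * pdy (fun w => (f w).2) z -
    pdx (fun w => (f w).2) z * pdy (fun w => (f w).1) z

/-- `γ` is a periodic solution of the vector field `X` whose image is contained in `S`:
a non-constant `C¹` curve solving `γ' = X ∘ γ` with some period `T > 0`. -/
def IsPeriodicSolOn (X : ℝ × ℝ → ℝ × ℝ) (S : Set (ℝ × ℝ)) (γ : ℝ → ℝ × ℝ) : Prop :=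
  (∀ t, γ t ∈ S) ∧ (∀ t, HasDerivAt γ (X (γ t)) t) ∧
    (∃ T > 0, ∀ t, γ (t + T) = γ t) ∧ ∃ t s, γ t ≠ γ s

/-- The Euclidean norm on `ℝ²`. -/
noncomputable def euclNorm (w : ℝ × ℝ) : ℝ := Real.sqrt (w.1 ^ 2 + w.2 ^ 2)

/-- The open Euclidean disc of radius `r` centered at the origin. -/
def disc (r : ℝ) : Set (ℝ × ℝ) := {w | euclNorm w < r}

/-- `W` is the period annulus of the singular point `z₀` of the vector field `X` on `U`:
the maximal open connected subset of `U` containing `z₀` all whose points other than `z₀`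
lie on periodic solutions of `X` contained in `W`. -/
def IsPeriodAnnulus (X : ℝ × ℝ → ℝ × ℝ) (U : Set (ℝ × ℝ)) (z₀ : ℝ × ℝ)
    (W : Set (ℝ × ℝ)) : Prop :=
  z₀ ∈ W ∧ W ⊆ U ∧ IsOpen W ∧ IsConnected W ∧
    (∀ z ∈ W \ {z₀}, ∃ γ, IsPeriodicSolOn X W γ ∧ γ 0 = z) ∧
    ∀ W', z₀ ∈ W' → W' ⊆ U → IsOpen W' → IsConnected W' →
      (∀ z ∈ W' \ {z₀}, ∃ γ, IsPeriodicSolOn X W' γ ∧ γ 0 = z) → W ⊆ W' → W' = W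

section Topology

open Metric Topology

variable {Y : Type*} [TopologicalSpace Y] {F : Y → ℂ}

/-- `V` is an open set containing `y₀` that `F` maps bijectively onto the disc of radius `r`. -/
def IsDiscSheet (F : Y → ℂ) (y₀ : Y) (V : Set Y) (r : ℝ) : Prop :=
  IsOpen V ∧ y₀ ∈ V ∧ InjOn F V ∧ 0 < r ∧ F '' V = ball 0 r

theorem isPreconnected_inter_preimage_of_injOn (ho : IsOpenMap F) {V : Set Y} (hV : IsOpen V)
    (hi : InjOn F V) {C : Set ℂ} (hC : IsPreconnected C) (hCV : C ⊆ F '' V) :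
    IsPreconnected (V ∩ F ⁻¹' C) := by
  have h1 : IsPreconnected (V.domRestrict F ⁻¹' C) :=
    hC.preimage_of_isOpenMap (injOn_iff_injective.1 hi) (ho.domRestrict hV)
      (by rw [range_domRestrict]; exact hCV)
  have h2 := h1.image Subtype.val continuous_subtype_val.continuousOn
  convert h2 using 1
  ext x
  simp [and_comm]

theorem IsLocalHomeomorph.exists_ball_sheet (hF : IsLocalHomeomorph F) (y : Y) :
    ∃ N, IsOpen N ∧ y ∈ N ∧ InjOn F N ∧ ∃ ε > 0, F '' N = ball (F y) ε := by
  obtain ⟨e, hy, rfl⟩ := hF y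
  obtain ⟨ε, hε, hb⟩ := Metric.isOpen_iff.1 e.open_target (e y) (e.map_source hy)
  refine ⟨e.source ∩ e ⁻¹' ball (e y) ε, e.open_source.inter (isOpen_ball.preimage hF.continuous),
    ⟨hy, mem_ball_self hε⟩, e.injOn.mono inter_subset_left, ε, hε, ?_⟩
  ext w
  constructor
  · rintro ⟨x, hx, rfl⟩
    exact hx.2
  · intro hw
    exact ⟨e.symm w, ⟨e.map_target (hb hw), by simpa [e.right_inv (hb hw)] using hw⟩,
      e.right_inv (hb hw)⟩

theorem IsDiscSheet.map_closure {y₀ : Y} {V : Set Y} {r : ℝ} (hF : IsLocalHomeomorph F)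
    (h : IsDiscSheet F y₀ V r) {y : Y} (hy : y ∈ closure V) : F y ∈ closedBall 0 r := by
  have := image_closure_subset_closure_image hF.continuous (mem_image_of_mem F hy)
  rw [h.2.2.2.2] at this
  exact closure_ball_subset_closedBall this

variable [T2Space Y]

theorem eq_of_mem_closure_of_injOn (hc : Continuous F) (ho : IsOpenMap F) {V : Set Y}
    (hV : IsOpen V) (hi : InjOn F V) {p y : Y} (hp : p ∈ V) (hy : y ∈ closure V)
    (hpy : F p = F y) : p = y := by
  by_contra hne
  obtain ⟨A, B, hA, hB, hpA, hyB, hAB⟩ := t2_separation hne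
  obtain ⟨q, ⟨hqB, a, ⟨haA, haV⟩, haq⟩, hqV⟩ := _root_.mem_closure_iff.1 hy
    (B ∩ F ⁻¹' (F '' (A ∩ V))) (hB.inter ((ho _ (hA.inter hV)).preimage hc))
    ⟨hyB, p, ⟨hpA, hp⟩, hpy⟩
  obtain rfl := hi haV hqV haq
  exact hAB.le_bot ⟨haA, hqB⟩

namespace IsDiscSheet

variable {y₀ : Y} {V : Set Y} {r : ℝ}

theorem mem_of_mem_closure (hF : IsLocalHomeomorph F) (h : IsDiscSheet F y₀ V r) {y : Y}
    (hy : y ∈ closure V) (hr : F y ∈ ball 0 r) : y ∈ V := by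
  obtain ⟨hV, -, hi, -, him⟩ := h
  rw [← him] at hr
  obtain ⟨p, hp, hpy⟩ := hr
  exact eq_of_mem_closure_of_injOn hF.continuous hF.isOpenMap hV hi hp hy hpy ▸ hp

theorem subset_of_le (hF : IsLocalHomeomorph F) (h : IsDiscSheet F y₀ V r) {V' : Set Y} {r' : ℝ}
    (h' : IsDiscSheet F y₀ V' r') (hr : r ≤ r') : V ⊆ V' := by
  have hpre : IsPreconnected V := by
    have := isPreconnected_inter_preimage_of_injOn hF.isOpenMap h.1 h.2.2.1
      (convex_ball (0 : ℂ) r).isPreconnected h.2.2.2.2.ge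
    rwa [inter_eq_left.2] at this
    exact image_subset_iff.1 h.2.2.2.2.le
  refine hpre.subset_of_closure_inter_subset h'.1 ⟨y₀, h.2.1, h'.2.1⟩ ?_
  rintro y ⟨hy, hyV⟩
  refine h'.mem_of_mem_closure hF hy (ball_subset_ball hr ?_)
  rw [← h.2.2.2.2]
  exact mem_image_of_mem F hyV

theorem exists_nhd (hF : IsLocalHomeomorph F) (h : IsDiscSheet F y₀ V r) {y : Y}
    (hy : y ∈ closure V) :
    ∃ N, IsOpen N ∧ y ∈ N ∧ N ∩ F ⁻¹' ball 0 r ⊆ V := by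
  obtain ⟨N, hN, hyN, hi, ε, hε, him⟩ := hF.exists_ball_sheet y
  refine ⟨N, hN, hyN, ?_⟩
  have hpre : IsPreconnected (N ∩ F ⁻¹' (ball (F y) ε ∩ ball 0 r)) :=
    isPreconnected_inter_preimage_of_injOn hF.isOpenMap hN hi
      ((convex_ball _ _).inter (convex_ball _ _)).isPreconnected (him ▸ inter_subset_left)
  have hsub : N ∩ F ⁻¹' ball 0 r ⊆ N ∩ F ⁻¹' (ball (F y) ε ∩ ball 0 r) := fun x hx =>
    ⟨hx.1, him ▸ mem_image_of_mem F hx.1, hx.2⟩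
  refine hsub.trans (hpre.subset_of_closure_inter_subset h.1 ?_ ?_)
  · obtain ⟨q, hqN, hqV⟩ := _root_.mem_closure_iff.1 hy N hN hyN
    exact ⟨q, hsub ⟨hqN, h.2.2.2.2 ▸ mem_image_of_mem F hqV⟩, hqV⟩
  · rintro x ⟨hx, hx'⟩
    exact h.mem_of_mem_closure hF hx hx'.2.2

theorem exists_nhd_closure (hF : IsLocalHomeomorph F) (h : IsDiscSheet F y₀ V r) {y : Y}
    (hy : y ∈ closure V) :
    ∃ N, IsOpen N ∧ y ∈ N ∧ N ∩ F ⁻¹' closedBall 0 r ⊆ closure V := by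
  obtain ⟨N, hN, hyN, hsub⟩ := h.exists_nhd hF hy
  refine ⟨N, hN, hyN, ?_⟩
  rintro x ⟨hxN, hx⟩
  rw [_root_.mem_closure_iff]
  intro O hO hxO
  rw [mem_preimage, ← closure_ball (0 : ℂ) h.2.2.2.1.ne'] at hx
  obtain ⟨w, ⟨q, ⟨hqO, hqN⟩, rfl⟩, hw⟩ := _root_.mem_closure_iff.1 hx _
    (hF.isOpenMap _ (hO.inter hN)) ⟨x, ⟨hxO, hxN⟩, rfl⟩
  exact ⟨q, hqO, hsub ⟨hqN, hw⟩⟩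

theorem injOn_closure (hF : IsLocalHomeomorph F) (h : IsDiscSheet F y₀ V r) :
    InjOn F (closure V) := by
  intro p hp q hq hpq
  by_contra hne
  obtain ⟨A, B, hA, hB, hpA, hqB, hAB⟩ := t2_separation hne
  obtain ⟨N, hN, hpN, hNs⟩ := h.exists_nhd hF hp
  obtain ⟨M, hM, hqM, hMs⟩ := h.exists_nhd hF hq
  have hx := h.map_closure hF hp
  rw [← closure_ball (0 : ℂ) h.2.2.2.1.ne'] at hx
  obtain ⟨w, ⟨⟨a, ⟨haA, haN⟩, rfl⟩, b, ⟨hbB, hbM⟩, hba⟩, hw⟩ := _root_.mem_closure_iff.1 hx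
    (F '' (A ∩ N) ∩ F '' (B ∩ M))
    ((hF.isOpenMap _ (hA.inter hN)).inter (hF.isOpenMap _ (hB.inter hM)))
    ⟨⟨p, ⟨hpA, hpN⟩, rfl⟩, ⟨q, ⟨hqB, hqM⟩, hpq.symm⟩⟩
  have hab : b = a := h.2.2.1 (hMs ⟨hbM, by rwa [mem_preimage, hba]⟩) (hNs ⟨haN, hw⟩) hba
  exact hAB.le_bot ⟨haA, hab ▸ hbB⟩

theorem isCompact_closure (hF : IsLocalHomeomorph F) (h : IsDiscSheet F y₀ V r)
    (hs : closedBall 0 r ⊆ F '' closure V) : IsCompact (closure V) := by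
  rw [isCompact_iff_ultrafilter_le_nhds]
  intro l hl
  have hlm : closure V ∈ (l : Filter Y) := Filter.le_principal_iff.1 hl
  have hlF : ↑(l.map F) ≤ Filter.principal (closedBall (0 : ℂ) r) := by
    rw [Filter.le_principal_iff]
    exact Filter.mem_map.2 (Filter.mem_of_superset hlm fun x hx => h.map_closure hF hx)
  obtain ⟨w, hw, hlw⟩ := isCompact_iff_ultrafilter_le_nhds.1 (isCompact_closedBall (0 : ℂ) r) _ hlF
  obtain ⟨p, hp, rfl⟩ := hs hw
  refine ⟨p, hp, ?_⟩
  obtain ⟨N, hN, hpN, hNs⟩ := h.exists_nhd_closure hF hp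
  intro O hO
  have h1 : F '' (interior O ∩ N) ∈ 𝓝 (F p) := (hF.isOpenMap _ (isOpen_interior.inter hN)).mem_nhds
    ⟨p, ⟨mem_interior_iff_mem_nhds.2 hO, hpN⟩, rfl⟩
  have h2 : F ⁻¹' (F '' (interior O ∩ N)) ∈ (l : Filter Y) := hlw h1
  filter_upwards [h2, hlm] with x hx hxV
  obtain ⟨q, ⟨hqO, hqN⟩, hqx⟩ := hx
  have hq : q ∈ closure V := hNs ⟨hqN, by
    rw [mem_preimage, hqx]; exact h.map_closure hF hxV⟩
  exact h.injOn_closure hF hq hxV hqx ▸ interior_subset hqO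

/-- A sheet over a disc extends to a sheet over a larger disc as soon as some point of its
boundary lies on a connected set covering the boundary circle. -/
theorem exists_lt (hF : IsLocalHomeomorph F) (h : IsDiscSheet F y₀ V r) {Γ : Set Y}
    (hΓ : IsPreconnected Γ) (hΓV : (Γ ∩ closure V).Nonempty) (hΓF : F '' Γ = sphere 0 r) :
    ∃ V' r', r < r' ∧ IsDiscSheet F y₀ V' r' := by
  have hΓs : Γ ⊆ closure V := by
    have hopen : IsOpen (⋃ N ∈ {N | IsOpen N ∧ N ∩ F ⁻¹' closedBall 0 r ⊆ closure V}, N) :=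
      isOpen_biUnion fun N hN => hN.1
    have hmem : ∀ x ∈ Γ, x ∈ (⋃ N ∈ {N | IsOpen N ∧ N ∩ F ⁻¹' closedBall 0 r ⊆ closure V}, N) →
        x ∈ closure V := by
      intro x hx hxN
      simp only [mem_iUnion] at hxN
      obtain ⟨N, hN, hxN⟩ := hxN
      refine hN.2 ⟨hxN, sphere_subset_closedBall ?_⟩
      rw [← hΓF]
      exact mem_image_of_mem F hx
    have hcl : ∀ x ∈ closure V,
        x ∈ (⋃ N ∈ {N | IsOpen N ∧ N ∩ F ⁻¹' closedBall 0 r ⊆ closure V}, N) := by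
      intro x hx
      obtain ⟨N, hN, hxN, hNs⟩ := h.exists_nhd_closure hF hx
      simp only [mem_iUnion]
      exact ⟨N, ⟨hN, hNs⟩, hxN⟩
    intro x hx
    by_contra hxV
    obtain ⟨y, hyΓ, hyV⟩ := hΓV
    obtain ⟨z, hz, hz1, hz2⟩ := hΓ _ _ hopen isClosed_closure.isOpen_compl (fun x _ => by
      by_cases hx : x ∈ closure V
      · exact Or.inl (hcl x hx)
      · exact Or.inr hx) ⟨y, hyΓ, hcl y hyV⟩ ⟨x, hx, hxV⟩
    exact hz2 (hmem z hz hz1)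
  have hs : closedBall 0 r ⊆ F '' closure V := by
    rw [← ball_union_sphere, ← h.2.2.2.2, ← hΓF]
    exact union_subset (image_mono subset_closure) (image_mono hΓs)
  have hcpt := h.isCompact_closure hF hs
  obtain ⟨t, ht, hti⟩ := (h.injOn_closure hF).exists_mem_nhdsSet hcpt
    (fun x _ => hF.continuous.continuousAt) (fun x _ => by
      obtain ⟨N, hN, hxN, hi, -⟩ := hF.exists_ball_sheet x
      exact ⟨N, hN.mem_nhds hxN, hi⟩)
  obtain ⟨O, hO, hVO, hOt⟩ := mem_nhdsSet_iff_exists.1 ht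
  obtain ⟨δ, hδ, hsub⟩ := (isCompact_closedBall (0 : ℂ) r).exists_thickening_subset_open
    (hF.isOpenMap _ hO) (hs.trans (image_mono hVO))
  rw [thickening_closedBall hδ h.2.2.2.1.le] at hsub
  refine ⟨O ∩ F ⁻¹' ball 0 (δ + r), δ + r, by linarith,
    hO.inter (isOpen_ball.preimage hF.continuous), ⟨hVO (subset_closure h.2.1), ?_⟩,
    hti.mono (inter_subset_left.trans hOt), by linarith [h.2.2.2.1], ?_⟩
  · refine ball_subset_ball (by linarith : r ≤ δ + r) ?_
    rw [← h.2.2.2.2]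
    exact mem_image_of_mem F h.2.1
  · rw [image_inter_preimage]
    exact inter_eq_right.2 hsub

end IsDiscSheet

/-- A local homeomorphism from a connected space to the plane that vanishes somewhere is injective
if every point is contained in a connected set covering a whole circle centred at the origin. -/
theorem IsLocalHomeomorph.injective_of_circles [ConnectedSpace Y] (hF : IsLocalHomeomorph F)
    {y₀ : Y} (h₀ : F y₀ = 0)
    (hΓ : ∀ y, F y ≠ 0 → ∃ Γ, IsPreconnected Γ ∧ y ∈ Γ ∧ F '' Γ = sphere 0 ‖F y‖) :
    Function.Injective F := by
  set W : Set Y := {y | ∃ V r, IsDiscSheet F y₀ V r ∧ y ∈ V}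
  have hWo : IsOpen W := by
    rw [isOpen_iff_mem_nhds]
    rintro y ⟨V, r, hV, hy⟩
    exact Filter.mem_of_superset (hV.1.mem_nhds hy) fun x hx => ⟨V, r, hV, hx⟩
  have hWi : InjOn F W := by
    rintro p ⟨V, r, hV, hp⟩ q ⟨V', r', hV', hq⟩ hpq
    rcases le_total r r' with hr | hr
    · exact hV'.2.2.1 (hV.subset_of_le hF hV' hr hp) hq hpq
    · exact hV.2.2.1 hp (hV'.subset_of_le hF hV hr hq) hpq
  have hbase : y₀ ∈ W := by
    obtain ⟨N, hN, hy, hi, ε, hε, him⟩ := hF.exists_ball_sheet y₀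
    exact ⟨N, ε, ⟨hN, hy, hi, hε, by rw [him, h₀]⟩, hy⟩
  have hWc : closure W ⊆ W := by
    intro y hy
    by_cases hex : ∃ V r, IsDiscSheet F y₀ V r ∧ ‖F y‖ < r
    · obtain ⟨V, r, hV, hr⟩ := hex
      have hyr : F y ∈ ball 0 r := mem_ball_zero_iff.2 hr
      rw [← hV.2.2.2.2] at hyr
      obtain ⟨p, hp, hpy⟩ := hyr
      have hpW : p ∈ W := ⟨V, r, hV, hp⟩
      exact eq_of_mem_closure_of_injOn hF.continuous hF.isOpenMap hWo hWi hpW hy hpy ▸ hpW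
    · exfalso
      push Not at hex
      have hpos : 0 < ‖F y‖ := by
        obtain ⟨V, r, hV, -⟩ := hbase
        exact hV.2.2.2.1.trans_le (hex V r hV)
      have hsheet : IsDiscSheet F y₀ W ‖F y‖ := by
        refine ⟨hWo, hbase, hWi, hpos, Subset.antisymm ?_ ?_⟩
        · rintro w ⟨p, ⟨V, r, hV, hp⟩, rfl⟩
          refine ball_subset_ball (hex V r hV) ?_
          rw [← hV.2.2.2.2]
          exact mem_image_of_mem F hp
        · intro w hw
          have hlt : ‖w‖ < ‖F y‖ := mem_ball_zero_iff.1 hw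
          obtain ⟨p, hp, hpW⟩ := _root_.mem_closure_iff.1 hy {x | ‖w‖ < ‖F x‖}
            (isOpen_lt continuous_const hF.continuous.norm) hlt
          obtain ⟨V, r, hV, hpV⟩ := hpW
          have hpr : F p ∈ ball 0 r := hV.2.2.2.2 ▸ mem_image_of_mem F hpV
          have hwr : w ∈ ball 0 r := mem_ball_zero_iff.2 (lt_trans hp (mem_ball_zero_iff.1 hpr))
          rw [← hV.2.2.2.2] at hwr
          obtain ⟨q, hq, rfl⟩ := hwr
          exact ⟨q, ⟨V, r, hV, hq⟩, rfl⟩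
      obtain ⟨Γ, hΓp, hyΓ, hΓF⟩ := hΓ y (norm_pos_iff.1 hpos)
      obtain ⟨V', r', hr', hV'⟩ := hsheet.exists_lt hF hΓp ⟨y, hyΓ, hy⟩ hΓF
      exact absurd (hex V' r' hV') (not_le.2 hr')
  have huniv : W = univ :=
    IsClopen.eq_univ ⟨isClosed_of_closure_subset hWc, hWo⟩ ⟨y₀, hbase⟩
  rw [huniv] at hWi
  exact injOn_univ.1 hWi

end Topology

/-- A periodic curve in the punctured plane which rotates about the origin with nowhere vanishing
angular speed covers the whole circle it lies on. -/
theorem exists_eq_of_rotating {u : ℝ → ℂ} {d : ℝ → ℝ}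
    (hu : ∀ t, HasDerivAt u (Complex.I * d t * u t) t) (hd : ∀ t, d t ≠ 0) {T : ℝ} (hT : 0 < T)
    (hper : u T = u 0) {ρ : ℝ} (hρ : 0 < ρ) (hnorm : ∀ t, ‖u t‖ = ρ) {w : ℂ} (hw : ‖w‖ = ρ) :
    ∃ t, u t = w := by
  by_contra! hne
  have hw0 : w ≠ 0 := norm_pos_iff.1 (hw ▸ hρ)
  have hu0 : ∀ t, u t ≠ 0 := fun t => norm_pos_iff.1 (hnorm t ▸ hρ)
  have hslit : ∀ t, u t / (-w) ∈ Complex.slitPlane := by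
    intro t
    rw [Complex.mem_slitPlane_iff_not_le_zero]
    intro hle
    have hn : ‖u t / (-w)‖ = 1 := by rw [norm_div, norm_neg, hnorm, hw, div_self hρ.ne']
    have h1 : u t / (-w) = -1 := by
      obtain ⟨hre, him⟩ := Complex.le_def.1 hle
      simp only [Complex.zero_re, Complex.zero_im] at hre him
      have heq : u t / (-w) = (((u t / (-w)).re : ℝ) : ℂ) := Complex.ext rfl (by simpa using him)
      rw [heq, Complex.norm_real, Real.norm_eq_abs, abs_of_nonpos hre] at hn
      rw [heq, show (u t / (-w)).re = -1 by linarith]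
      simp
    rw [div_eq_iff (neg_ne_zero.2 hw0)] at h1
    exact hne t (by simpa using h1)
  have hder : ∀ t, HasDerivAt (fun t => (Complex.log (u t / (-w))).im) (d t) t := by
    intro t
    have h1 := ((hu t).div_const (-w)).clog_real (hslit t)
    have h2 : Complex.I * d t * u t / (-w) / (u t / (-w)) = Complex.I * d t := by
      have := hu0 t
      field_simp
    rw [h2] at h1
    have h3 := Complex.imCLM.hasFDerivAt.comp_hasDerivAt t h1
    simpa [Function.comp_def] using h3
  obtain ⟨c, -, hc⟩ := exists_hasDerivAt_eq_zero hT
    (fun t _ => (hder t).continuousAt.continuousWithinAt)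
    (by simp only [hper]) (fun t _ => hder t)
  exact hd c hc

section Hamiltonian

variable {U : Set (ℝ × ℝ)} {f : ℝ × ℝ → ℝ × ℝ}

/-- The plane map `f` viewed as a complex-valued function. -/
noncomputable def toComplex (f : ℝ × ℝ → ℝ × ℝ) (z : ℝ × ℝ) : ℂ :=
  Complex.equivRealProdCLM.symm (f z)

theorem toComplex_apply (z : ℝ × ℝ) : toComplex f z = ⟨(f z).1, (f z).2⟩ := by
  apply Complex.ext <;> simp [toComplex]

theorem Ham_eq_norm_toComplex (z : ℝ × ℝ) : Ham f z = ‖toComplex f z‖ ^ 2 / 2 := by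
  rw [← Complex.normSq_eq_norm_sq, toComplex_apply, Complex.normSq_mk, Ham]
  ring

theorem pdx_fst {z : ℝ × ℝ} (hf : DifferentiableAt ℝ f z) :
    pdx (fun w => (f w).1) z = (fderiv ℝ f z (1, 0)).1 := by
  rw [pdx, hf.hasFDerivAt.fst.fderiv]; rfl

theorem pdy_fst {z : ℝ × ℝ} (hf : DifferentiableAt ℝ f z) :
    pdy (fun w => (f w).1) z = (fderiv ℝ f z (0, 1)).1 := by
  rw [pdy, hf.hasFDerivAt.fst.fderiv]; rfl

theorem pdx_snd {z : ℝ × ℝ} (hf : DifferentiableAt ℝ f z) :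
    pdx (fun w => (f w).2) z = (fderiv ℝ f z (1, 0)).2 := by
  rw [pdx, hf.hasFDerivAt.snd.fderiv]; rfl

theorem pdy_snd {z : ℝ × ℝ} (hf : DifferentiableAt ℝ f z) :
    pdy (fun w => (f w).2) z = (fderiv ℝ f z (0, 1)).2 := by
  rw [pdy, hf.hasFDerivAt.snd.fderiv]; rfl

theorem jacDet_eq {z : ℝ × ℝ} (hf : DifferentiableAt ℝ f z) :
    jacDet f z = (fderiv ℝ f z (1, 0)).1 * (fderiv ℝ f z (0, 1)).2 -
      (fderiv ℝ f z (1, 0)).2 * (fderiv ℝ f z (0, 1)).1 := by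
  rw [jacDet, pdx_fst hf, pdy_fst hf, pdx_snd hf, pdy_snd hf]

theorem fderiv_apply_eq (z v : ℝ × ℝ) :
    fderiv ℝ f z v = v.1 • fderiv ℝ f z (1, 0) + v.2 • fderiv ℝ f z (0, 1) := by
  rw [← map_smul, ← map_smul, ← map_add]
  congr 1
  ext <;> simp

theorem fderiv_Ham {z : ℝ × ℝ} (hf : DifferentiableAt ℝ f z) (v : ℝ × ℝ) :
    fderiv ℝ (Ham f) z v =
      (f z).1 * (fderiv ℝ f z v).1 + (f z).2 * (fderiv ℝ f z v).2 := by
  have h1 := hf.hasFDerivAt.fst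
  have h2 := hf.hasFDerivAt.snd
  have h : HasFDerivAt (fun w => ((f w).1 ^ 2 + (f w).2 ^ 2) * (2 : ℝ)⁻¹) _ z :=
    ((h1.pow 2).add (h2.pow 2)).mul_const (2 : ℝ)⁻¹
  have hH : Ham f = fun w => ((f w).1 ^ 2 + (f w).2 ^ 2) * (2 : ℝ)⁻¹ := by
    funext w; rw [Ham, div_eq_mul_inv]
  rw [hH, h.fderiv]
  simp
  ring

/-- In the image plane the Hamiltonian flow rotates about the origin with speed `det Df`. -/
theorem fderiv_hamVF {z : ℝ × ℝ} (hf : DifferentiableAt ℝ f z) :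
    fderiv ℝ f z (hamVF f z) = (-(jacDet f z * (f z).2), jacDet f z * (f z).1) := by
  rw [fderiv_apply_eq, jacDet_eq hf, hamVF, pdx, pdy, fderiv_Ham hf, fderiv_Ham hf]
  ext <;> simp <;> ring

theorem hasDerivAt_toComplex_comp {γ : ℝ → ℝ × ℝ} {t : ℝ} (hf : DifferentiableAt ℝ f (γ t))
    (hγ : HasDerivAt γ (hamVF f (γ t)) t) :
    HasDerivAt (fun t => toComplex f (γ t))
      (Complex.I * jacDet f (γ t) * toComplex f (γ t)) t := by
  have h1 := hf.hasFDerivAt.comp_hasDerivAt t hγ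
  rw [fderiv_hamVF hf] at h1
  have h2 := Complex.equivRealProdCLM.symm.hasFDerivAt.comp_hasDerivAt t h1
  have h3 : Complex.I * jacDet f (γ t) * toComplex f (γ t) = Complex.equivRealProdCLM.symm
      (-(jacDet f (γ t) * (f (γ t)).2), jacDet f (γ t) * (f (γ t)).1) := by
    rw [toComplex_apply]
    apply Complex.ext <;> simp
  rw [h3]
  exact h2

theorem norm_eq_of_rotating {u : ℝ → ℂ} {d : ℝ → ℝ}
    (hu : ∀ t, HasDerivAt u (Complex.I * d t * u t) t) (s t : ℝ) : ‖u s‖ = ‖u t‖ := by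
  have hder : ∀ t, HasDerivAt (fun t => ‖u t‖ ^ 2) 0 t := by
    intro t
    convert (hu t).norm_sq using 1
    rw [Complex.inner]
    simp
    ring
  have h := is_const_of_deriv_eq_zero (fun t => (hder t).differentiableAt)
    (fun t => (hder t).deriv) s t
  exact (sq_eq_sq₀ (norm_nonneg _) (norm_nonneg _)).1 h

theorem image_range_periodicSol (hd : ∀ z ∈ U, DifferentiableAt ℝ f z)
    (hdet : ∀ z ∈ U, jacDet f z ≠ 0) {γ : ℝ → ℝ × ℝ} (hγ : IsPeriodicSolOn (hamVF f) U γ)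
    (h0 : toComplex f (γ 0) ≠ 0) :
    range (fun t => toComplex f (γ t)) = Metric.sphere 0 ‖toComplex f (γ 0)‖ := by
  obtain ⟨hU, hder, ⟨T, hT, hper⟩, -⟩ := hγ
  have hu := fun t => hasDerivAt_toComplex_comp (hd _ (hU t)) (hder t)
  have hn := norm_eq_of_rotating hu
  refine Subset.antisymm ?_ ?_
  · rintro _ ⟨t, rfl⟩
    exact mem_sphere_zero_iff_norm.2 (hn t 0)
  · intro w hw
    exact exists_eq_of_rotating hu (fun t => hdet _ (hU t)) hT
      (by simp only [← hper 0, zero_add]) (norm_pos_iff.2 h0) (fun t => hn t 0)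
      (mem_sphere_zero_iff_norm.1 hw)

theorem isLocalHomeomorph_restrict_toComplex (hUo : IsOpen U) (hf : ContDiffOn ℝ 2 f U)
    (hdet : ∀ z ∈ U, jacDet f z ≠ 0) :
    IsLocalHomeomorph (fun z : U => toComplex f z) := by
  have hon : IsLocalHomeomorphOn f U := by
    refine IsLocalHomeomorphOn.mk f U fun z hz => ?_
    have hfz := hf.contDiffAt (hUo.mem_nhds hz)
    have hdz := hfz.differentiableAt (by norm_num)
    have hinj : Function.Injective (fderiv ℝ f z) := by
      rw [injective_iff_map_eq_zero]
      intro v hv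
      have hdz' := hdet z hz
      rw [jacDet_eq hdz] at hdz'
      rw [fderiv_apply_eq] at hv
      have e1 := congrArg Prod.fst hv
      have e2 := congrArg Prod.snd hv
      simp only [Prod.fst_add, Prod.snd_add, Prod.smul_fst, Prod.smul_snd, smul_eq_mul,
        Prod.fst_zero, Prod.snd_zero] at e1 e2
      ext
      · refine (mul_eq_zero.1 ?_).resolve_right hdz'
        linear_combination (fderiv ℝ f z (0, 1)).2 * e1 - (fderiv ℝ f z (0, 1)).1 * e2
      · refine (mul_eq_zero.1 ?_).resolve_right hdz'
        linear_combination (fderiv ℝ f z (1, 0)).1 * e2 - (fderiv ℝ f z (1, 0)).2 * e1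
    let L : (ℝ × ℝ) ≃L[ℝ] (ℝ × ℝ) :=
      (LinearEquiv.ofInjectiveEndo (fderiv ℝ f z : (ℝ × ℝ) →ₗ[ℝ] (ℝ × ℝ))
        hinj).toContinuousLinearEquiv
    have hL : (L : (ℝ × ℝ) →L[ℝ] (ℝ × ℝ)) = fderiv ℝ f z := by ext <;> rfl
    have hs : HasStrictFDerivAt f (L : (ℝ × ℝ) →L[ℝ] (ℝ × ℝ)) z := by
      rw [hL]; exact hfz.hasStrictFDerivAt (by norm_num)
    exact ⟨hs.toOpenPartialHomeomorph f, hs.mem_toOpenPartialHomeomorph_source, fun _ _ => rfl⟩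
  have hval : IsLocalHomeomorph (fun z : U => f z) := by
    rw [isLocalHomeomorph_iff_isLocalHomeomorphOn_univ]
    exact hon.comp hUo.isOpenEmbedding_subtypeVal.isLocalHomeomorph.isLocalHomeomorphOn
      (fun z _ => z.2)
  exact Complex.equivRealProdCLM.symm.toHomeomorph.isLocalHomeomorph.comp hval

end Hamiltonian

theorem global_center_level_sets_connected (U : Set (ℝ × ℝ)) (hUo : IsOpen U)
    (hUc : IsConnected U) (f : ℝ × ℝ → ℝ × ℝ) (hf : ContDiffOn ℝ 2 f U)
    (hdet : ∀ z ∈ U, jacDet f z ≠ 0)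
    (z₀ : ℝ × ℝ) (hz₀ : z₀ ∈ U) (hfz : f z₀ = (0, 0))
    (hglobal : ∀ z ∈ U \ {z₀}, ∃ γ, IsPeriodicSolOn (hamVF f) U γ ∧ γ 0 = z) :
    ∀ h : ℝ, IsPreconnected {z | z ∈ U ∧ Ham f z = h} := by
  have hd : ∀ z ∈ U, DifferentiableAt ℝ f z := fun z hz =>
    (hf.contDiffAt (hUo.mem_nhds hz)).differentiableAt (by norm_num)
  have h₀ : toComplex f z₀ = 0 := by rw [toComplex_apply, hfz]; rfl
  have horbit : ∀ z ∈ U, toComplex f z ≠ 0 →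
      ∃ γ, IsPeriodicSolOn (hamVF f) U γ ∧ γ 0 = z := fun z hz hne =>
    hglobal z ⟨hz, fun h => hne (by rw [mem_singleton_iff.1 h, h₀])⟩
  have hcont : ∀ γ, IsPeriodicSolOn (hamVF f) U γ → Continuous γ := fun γ hγ =>
    continuous_iff_continuousAt.2 fun t => (hγ.2.1 t).continuousAt
  have hinj : Function.Injective (fun z : U => toComplex f z) := by
    have : ConnectedSpace U := isConnected_iff_connectedSpace.1 hUc
    refine (isLocalHomeomorph_restrict_toComplex hUo hf hdet).injective_of_circles
      (y₀ := ⟨z₀, hz₀⟩) h₀ ?_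
    rintro ⟨z, hz⟩ hne
    obtain ⟨γ, hγ, rfl⟩ := horbit z hz hne
    refine ⟨range fun t => (⟨γ t, hγ.1 t⟩ : U),
      isPreconnected_range ((hcont γ hγ).subtype_mk _), ⟨0, rfl⟩, ?_⟩
    rw [← range_comp]
    exact image_range_periodicSol hd hdet hγ hne
  intro h
  by_cases hex : ∃ z ∈ U, Ham f z = h ∧ toComplex f z ≠ 0
  · obtain ⟨z, hz, rfl, hne⟩ := hex
    obtain ⟨γ, hγ, rfl⟩ := horbit z hz hne
    have him := image_range_periodicSol hd hdet hγ hne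
    have hlevel : ∀ x, Ham f x = Ham f (γ 0) ↔
        toComplex f x ∈ Metric.sphere 0 ‖toComplex f (γ 0)‖ := by
      intro x
      rw [Ham_eq_norm_toComplex, Ham_eq_norm_toComplex, mem_sphere_zero_iff_norm,
        div_left_inj' two_ne_zero, sq_eq_sq₀ (norm_nonneg _) (norm_nonneg _)]
    convert isPreconnected_range (hcont γ hγ) using 1
    ext x
    rw [mem_ofPred_eq, hlevel, ← him]
    constructor
    · rintro ⟨hx, t, ht⟩
      exact ⟨t, congrArg Subtype.val (@hinj ⟨γ t, hγ.1 t⟩ ⟨x, hx⟩ ht)⟩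
    · rintro ⟨t, rfl⟩
      exact ⟨hγ.1 t, t, rfl⟩
  · push Not at hex
    refine Set.Subsingleton.isPreconnected fun x hx y hy => ?_
    exact congrArg Subtype.val (@hinj ⟨x, hx.1⟩ ⟨y, hy.1⟩
      ((hex x hx.1 hx.2).trans (hex y hy.1 hy.2).symm))
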